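/- For every point z = (x,y,t) ∈ Q_θ⁻ with t < 0, the cut-off function φ₀ satisfies (−y ∂_x − ∂_t) φ₀(z) ≤ 0. -/

import Mathlib

open Real Set

noncomputable section

/-- The properties of the cut-off profile `χ` associated with the parameters `θ, r`. -/
def ChiProp (θ r : ℝ) (χ : ℝ → ℝ) : Prop :=
  ContDiff ℝ (⊤ : ℕ∞) χ ∧
  AntitoneOn χ (Ici 0) ∧
  (∀ s, 0 ≤ s → 0 ≤ χ s ∧ χ s ≤ 1) ∧
  (∀ s ∈ Icc 0 (θ ^ ((1:ℝ)/6) * r), χ s = 1) ∧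
  (∀ s, r ≤ s → χ s = 0) ∧
  (∀ s ∈ Ico (0:ℝ) r, 0 < χ s) ∧
  (∀ s, θ ^ ((1:ℝ)/6) * r < s → χ s < 1) ∧
  (∀ s, 0 ≤ s → |deriv χ s| ≤ 2 / ((1 - θ ^ ((1:ℝ)/6)) * r))

/-- The cut-off `φ₀(x,y,t) = χ((θ²x² - 6tr⁴)^{1/6})`. -/
def phi0 (θ r : ℝ) (χ : ℝ → ℝ) (z : ℝ × ℝ × ℝ) : ℝ :=
  χ ((θ ^ 2 * z.1 ^ 2 - 6 * z.2.2 * r ^ 4) ^ ((1:ℝ)/6))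

/-- The cut-off `φ₁(x,y,t) = χ(θ|y|)`. -/
def phi1 (θ : ℝ) (χ : ℝ → ℝ) (z : ℝ × ℝ × ℝ) : ℝ := χ (θ * |z.2.1|)

/-- The full cut-off `φ = φ₀ φ₁`. -/
def phiCut (θ r : ℝ) (χ : ℝ → ℝ) (z : ℝ × ℝ × ℝ) : ℝ := phi0 θ r χ z * phi1 θ χ z

/-- The region `Q_θ⁻ = {-r² ≤ t ≤ 0, |y| ≤ r/θ, |x| ≤ r³/θ}`. -/
def Qneg (θ r : ℝ) : Set (ℝ × ℝ × ℝ) :=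
  {z | -r ^ 2 ≤ z.2.2 ∧ z.2.2 ≤ 0 ∧ |z.2.1| ≤ r / θ ∧ |z.1| ≤ r ^ 3 / θ}

/-- A function antitone on `[0, ∞)` has nonpositive derivative at positive points. -/
lemma deriv_nonpos_of_antitoneOn_Ici {f : ℝ → ℝ} (hf : AntitoneOn f (Ici 0)) {s : ℝ} (hs : 0 < s) :
    deriv f s ≤ 0 := by
  rw [← derivWithin_of_mem_nhds (Ici_mem_nhds hs)]
  exact hf.derivWithin_nonpos

/-- The coefficient of the transport derivative of `θ²x² - 6tr⁴` has a sign on `Q_θ⁻`. -/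
lemma transport_coefficient_nonneg {θ r x y : ℝ} (hθ : 0 < θ)
    (hy : |y| ≤ r / θ) (hx : |x| ≤ r ^ 3 / θ) :
    0 ≤ -y * (2 * θ ^ 2 * x) + 6 * r ^ 4 := by
  have hprod : |y| * |x| ≤ r / θ * (r ^ 3 / θ) :=
    mul_le_mul hy hx (abs_nonneg x) ((abs_nonneg y).trans hy)
  have hxy : y * x ≤ r / θ * (r ^ 3 / θ) := by
    rw [← abs_mul] at hprod
    exact (le_abs_self _).trans hprod
  have hscaled : θ ^ 2 * (y * x) ≤ r ^ 4 := by
    calc θ ^ 2 * (y * x) ≤ θ ^ 2 * (r / θ * (r ^ 3 / θ)) := by gcongr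
      _ = r ^ 4 := by field_simp
  nlinarith [sq_nonneg (r ^ 2)]

/-- Lemma 4.4 (1): `(-y ∂_x - ∂_t) φ₀ ≤ 0` on `Q_θ⁻ ∩ {t < 0}`. -/
theorem phi0_transport_sign (θ r : ℝ) (hθ : θ ∈ Ioo (0:ℝ) ((2:ℝ) ^ 6)⁻¹)
    (hr : r ∈ Ioc (0:ℝ) 1) (χ : ℝ → ℝ) (hχ : ChiProp θ r χ)
    (z : ℝ × ℝ × ℝ) (hz : z ∈ Qneg θ r) (hzt : z.2.2 < 0) :
    -z.2.1 * deriv (fun s => phi0 θ r χ (s, z.2.1, z.2.2)) z.1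
      - deriv (fun s => phi0 θ r χ (z.1, z.2.1, s)) z.2.2 ≤ 0 := by
  obtain ⟨x, y, t⟩ := z
  obtain ⟨-, -, hy, hx⟩ := hz
  obtain ⟨hsmooth, hanti, -⟩ := hχ
  simp only at hy hx hzt ⊢
  have hr4 : 0 < r ^ 4 := pow_pos hr.1 4
  set u : ℝ := θ ^ 2 * x ^ 2 - 6 * t * r ^ 4
  have hu0 : 0 < u := by
    have hneg : t * r ^ 4 < 0 := mul_neg_of_neg_of_pos hzt hr4
    nlinarith [sq_nonneg (θ * x)]
  have hχd : HasDerivAt χ (deriv χ (u ^ ((1:ℝ)/6))) (u ^ ((1:ℝ)/6)) :=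
    (hsmooth.differentiable (by simp) _).hasDerivAt
  have hprofile : HasDerivAt (fun v : ℝ => χ (v ^ ((1:ℝ)/6)))
      (deriv χ (u ^ ((1:ℝ)/6)) * ((1:ℝ)/6 * u ^ ((1:ℝ)/6 - 1))) u :=
    hχd.comp u (Real.hasDerivAt_rpow_const (Or.inl hu0.ne'))
  set d : ℝ := deriv χ (u ^ ((1:ℝ)/6)) * ((1:ℝ)/6 * u ^ ((1:ℝ)/6 - 1))
  have hd : d ≤ 0 :=
    mul_nonpos_of_nonpos_of_nonneg
      (deriv_nonpos_of_antitoneOn_Ici hanti (Real.rpow_pos_of_pos hu0 _)) (by positivity)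
  have hux : HasDerivAt (fun s : ℝ => θ ^ 2 * s ^ 2 - 6 * t * r ^ 4) (2 * θ ^ 2 * x) x :=
    (((hasDerivAt_pow 2 x).const_mul (θ ^ 2)).sub_const (6 * t * r ^ 4)).congr_deriv
      (by push_cast; ring)
  have hut : HasDerivAt (fun s : ℝ => θ ^ 2 * x ^ 2 - 6 * s * r ^ 4) (-(6 * r ^ 4)) t :=
    ((((hasDerivAt_id t).const_mul 6).mul_const (r ^ 4)).const_sub (θ ^ 2 * x ^ 2)).congr_deriv
      (by ring)
  have hdx : deriv (fun s => phi0 θ r χ (s, y, t)) x = d * (2 * θ ^ 2 * x) :=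
    (HasDerivAt.comp (h₂ := fun v : ℝ => χ (v ^ ((1:ℝ)/6))) x hprofile hux).deriv
  have hdt : deriv (fun s => phi0 θ r χ (x, y, s)) t = d * (-(6 * r ^ 4)) :=
    (HasDerivAt.comp (h₂ := fun v : ℝ => χ (v ^ ((1:ℝ)/6))) t hprofile hut).deriv
  rw [hdx, hdt]
  have hsign := mul_nonpos_of_nonpos_of_nonneg hd (transport_coefficient_nonneg hθ.1 hy hx)
  linarith

end
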